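/- Let (a_{ij})_{i,j=1}^{n} be an n × n matrix with all entries in {0,1}. Then there exist ε₁, …, ε_n ∈ {−1, 1} such that for every 1 ≤ i ≤ n one has |Σ_{j=1}^{n} ε_j a_{ij}| ≤ √(2 n log(2n)). -/

import Mathlib

open Finset

/-- Signs can be chosen one column at a time so that adding a column multiplies the potential
`∑ i, cosh (t * ∑ j, e j * a i j)` by at most `exp (t ^ 2 / 2)`. -/
theorem exists_signs_sum_cosh_le {ι κ : Type*} [Fintype ι] [DecidableEq κ] (a : ι → κ → ℝ)
    (ha : ∀ i j, |a i j| ≤ 1) (t : ℝ) (s : Finset κ) :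
    ∃ e : κ → ℝ, (∀ j, e j = -1 ∨ e j = 1) ∧
      ∑ i, Real.cosh (t * ∑ j ∈ s, e j * a i j) ≤
        Fintype.card ι * Real.exp (s.card * (t ^ 2 / 2)) := by
  induction s using Finset.induction_on with
  | empty => exact ⟨fun _ => 1, by simp, by simp⟩
  | insert k s hk ih =>
    obtain ⟨e, he, hs⟩ := ih
    have sum_update (c : ℝ) (i : ι) :
        ∑ j ∈ insert k s, Function.update e k c j * a i j =
          c * a i k + ∑ j ∈ s, e j * a i j := by
      rw [sum_insert hk, Function.update_self]
      congr 1
      refine sum_congr rfl fun j hj => ?_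
      rw [Function.update_of_ne (ne_of_mem_of_not_mem hj hk)]
    have sign_update (c : ℝ) (hc : c = -1 ∨ c = 1) (j : κ) :
        Function.update e k c j = -1 ∨ Function.update e k c j = 1 := by
      rcases eq_or_ne j k with rfl | hj
      · simpa using hc
      · simpa [hj] using he j
    have cosh_le (i : ι) : Real.cosh (t * a i k) ≤ Real.exp (t ^ 2 / 2) := by
      refine (Real.cosh_le_exp_half_sq _).trans (Real.exp_le_exp.2 ?_)
      have := (sq_le_one_iff_abs_le_one _).2 (ha i k)
      nlinarith [sq_nonneg t]
    have card_exp : Fintype.card ι * Real.exp ((insert k s).card * (t ^ 2 / 2)) =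
        Fintype.card ι * Real.exp (s.card * (t ^ 2 / 2)) * Real.exp (t ^ 2 / 2) := by
      rw [card_insert_of_notMem hk, mul_assoc, ← Real.exp_add]
      push_cast
      ring_nf
    have sum_le : ∑ i, Real.cosh (t * (1 * a i k + ∑ j ∈ s, e j * a i j)) +
        ∑ i, Real.cosh (t * (-1 * a i k + ∑ j ∈ s, e j * a i j)) ≤
        2 * (Fintype.card ι * Real.exp ((insert k s).card * (t ^ 2 / 2))) := by
      calc _ = 2 * ∑ i, Real.cosh (t * ∑ j ∈ s, e j * a i j) * Real.cosh (t * a i k) := by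
            rw [← sum_add_distrib, mul_sum]
            refine sum_congr rfl fun i _ => ?_
            rw [mul_add, mul_add, Real.cosh_add, Real.cosh_add,
              show t * (-1 * a i k) = -(t * a i k) by ring, Real.cosh_neg, Real.sinh_neg, one_mul]
            ring
        _ ≤ 2 * ∑ i, Real.cosh (t * ∑ j ∈ s, e j * a i j) * Real.exp (t ^ 2 / 2) := by
            gcongr with i
            exact cosh_le i
        _ ≤ _ := by
            rw [card_exp, ← sum_mul]
            gcongr
    by_cases h : ∑ i, Real.cosh (t * (1 * a i k + ∑ j ∈ s, e j * a i j)) ≤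
        Fintype.card ι * Real.exp ((insert k s).card * (t ^ 2 / 2))
    · exact ⟨_, sign_update 1 (.inr rfl), by simpa only [sum_update] using h⟩
    · exact ⟨_, sign_update (-1) (.inl rfl), by simp only [sum_update]; linarith⟩

/-- Alon–Spencer: for any `n × n` 0/1-matrix `(a_{ij})` there are signs
`ε₁,…,ε_n ∈ {−1,1}` such that every signed row sum satisfies
`|Σ_j ε_j a_{ij}| ≤ √(2 n log(2n))`. -/
theorem stmt12 (n : ℕ) (a : Fin n → Fin n → ℝ) (ha : ∀ i j, a i j = 0 ∨ a i j = 1) :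
    ∃ e : Fin n → ℝ, (∀ j, e j = -1 ∨ e j = 1) ∧
      ∀ i, |∑ j, e j * a i j| ≤ Real.sqrt (2 * n * Real.log (2 * n)) := by
  rcases n.eq_zero_or_pos with rfl | hn
  · exact ⟨fun _ => 1, by simp, fun i => i.elim0⟩
  have hn1 : (1 : ℝ) ≤ n := by exact_mod_cast hn
  have hlog : 0 < Real.log (2 * n) := Real.log_pos (by linarith)
  set r := Real.sqrt (2 * n * Real.log (2 * n))
  have r_pos : 0 < r := Real.sqrt_pos.2 (by positivity)
  have r_sq : r ^ 2 = 2 * n * Real.log (2 * n) := Real.sq_sqrt (by positivity)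
  obtain ⟨e, he, h⟩ := exists_signs_sum_cosh_le a
    (fun i j => by rcases ha i j with h | h <;> simp [h]) (r / n) univ
  refine ⟨e, he, fun i => ?_⟩
  set x := ∑ j, e j * a i j
  have cosh_le : Real.cosh (r / n * x) ≤ n * Real.exp (n * ((r / n) ^ 2 / 2)) := by
    have := single_le_sum (f := fun i => Real.cosh (r / n * ∑ j, e j * a i j))
      (fun i _ => (Real.cosh_pos _).le) (mem_univ i)
    simpa using this.trans h
  have exponent : n * ((r / n) ^ 2 / 2) = Real.log (2 * n) := by
    rw [div_pow, r_sq]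
    field_simp
  have exp_le : Real.exp (r / n * |x|) ≤ Real.exp (2 * Real.log (2 * n)) := by
    have abs_eq : |r / n * x| = r / n * |x| := by rw [abs_mul, abs_of_pos (by positivity)]
    rw [← Real.cosh_abs, abs_eq, exponent, Real.exp_log (by positivity), Real.cosh_eq] at cosh_le
    rw [two_mul (Real.log _), Real.exp_add, Real.exp_log (by positivity)]
    linarith [Real.exp_pos (-(r / n * |x|))]
  have := Real.exp_le_exp.1 exp_le
  rw [div_mul_eq_mul_div, div_le_iff₀ (by positivity)] at this
  exact le_of_mul_le_mul_left (by linarith) r_pos
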